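/- Assume f : ℝⁿ → ℝ and g : ℝᵐ → ℝ are differentiable convex functions, α, β, ε : [t₀, ∞) → (0, ∞) are C¹, θ > 0 and t₀ > 0 are constants, K : ℝⁿ → ℝᵐ is linear with adjoint K*, α(t) ≥ (1 + θ)/(θ t), β′(t)/β(t) ≤ (1 − 2θ)/(θ t), and α(t) + tα′(t) ≤ tβ(t)ε(t) for all t ≥ t₀, ε is nonincreasing with ∫_{t₀}^∞ (β(t)ε(t)/t) dt < ∞, and there exists D₂ > 0 such that D₂ ≤ θ t α(t) − θ − 1 for all t ≥ t₀. Then for every twice continuously differentiable global solution (x(t), y(t)) of the dynamical system (15), lim_{t→∞} ‖ẋ(t)‖ = 0 and lim_{t→∞} ‖ẏ(t)‖ = 0. -/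

import Mathlib

open scoped RealInnerProductSpace
open MeasureTheory Filter Asymptotics

noncomputable section

/-- The bilinear Lagrangian `L(x, y) = f(x) + ⟨Kx, y⟩ - g(y)`. -/
def Lag {n m : ℕ} (f : EuclideanSpace ℝ (Fin n) → ℝ) (g : EuclideanSpace ℝ (Fin m) → ℝ)
    (K : EuclideanSpace ℝ (Fin n) →L[ℝ] EuclideanSpace ℝ (Fin m))
    (x : EuclideanSpace ℝ (Fin n)) (y : EuclideanSpace ℝ (Fin m)) : ℝ :=
  f x + ⟪K x, y⟫ - g y

/-- `(x*, y*)` is a saddle point of the Lagrangian `L`: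
`L(x*, y) ≤ L(x*, y*) ≤ L(x, y*)` for all `(x, y)`. -/
def IsSaddle {n m : ℕ} (f : EuclideanSpace ℝ (Fin n) → ℝ) (g : EuclideanSpace ℝ (Fin m) → ℝ)
    (K : EuclideanSpace ℝ (Fin n) →L[ℝ] EuclideanSpace ℝ (Fin m))
    (xs : EuclideanSpace ℝ (Fin n)) (ys : EuclideanSpace ℝ (Fin m)) : Prop :=
  ∀ x y, Lag f g K xs y ≤ Lag f g K xs ys ∧ Lag f g K xs ys ≤ Lag f g K x ys

/-- `(x, y)` is a twice continuously differentiable global solution on `[t₀, ∞)` of the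
Tikhonov regularized second-order primal-dual dynamical system (15):
`ẍ + α(t)ẋ + β(t)[∇f(x) + ε(t)x + K*(y + θtẏ)] = 0`,
`ÿ + α(t)ẏ − β(t)[K(x + θtẋ) − ∇g(y) − ε(t)y] = 0`. -/
def IsSol {n m : ℕ} (t₀ θ : ℝ)
    (f : EuclideanSpace ℝ (Fin n) → ℝ) (g : EuclideanSpace ℝ (Fin m) → ℝ)
    (K : EuclideanSpace ℝ (Fin n) →L[ℝ] EuclideanSpace ℝ (Fin m))
    (α β ε : ℝ → ℝ)
    (x : ℝ → EuclideanSpace ℝ (Fin n)) (y : ℝ → EuclideanSpace ℝ (Fin m)) : Prop :=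
  ContDiffOn ℝ 2 x (Set.Ici t₀) ∧ ContDiffOn ℝ 2 y (Set.Ici t₀) ∧
  ∀ t ≥ t₀,
    deriv (deriv x) t + α t • deriv x t
      + β t • (gradient f (x t) + ε t • x t
        + (ContinuousLinearMap.adjoint K) (y t + (θ * t) • deriv y t)) = 0 ∧
    deriv (deriv y) t + α t • deriv y t
      - β t • (K (x t + (θ * t) • deriv x t) - gradient g (y t) - ε t • y t) = 0

lemma energy_decay (t₁ C : ℝ) (E E' h : ℝ → ℝ) (ht₁ : 0 < t₁) (hC : 0 ≤ C)
    (hE : ∀ s ≥ t₁, HasDerivAt E (E' s) s)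
    (hE' : ∀ s ≥ t₁, E' s ≤ C * (s ^ 2 * h s))
    (hE0 : ∀ s ≥ t₁, 0 ≤ E s)
    (hh : ∀ s ≥ t₁, 0 ≤ h s) (hc : ∀ s ≥ t₁, ContinuousAt h s)
    (hi : IntegrableOn h (Set.Ioi t₁)) :
    Tendsto (fun t => E t / t ^ 2) atTop (nhds 0) := by
  have hco : ContinuousOn h (Set.Ici t₁) := fun s hs => (hc s hs).continuousWithinAt
  set H : ℝ → ℝ := fun s => ∫ u in t₁..s, h u with hH
  have hII : ∀ a b, t₁ ≤ a → t₁ ≤ b → IntervalIntegrable h volume a b := by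
    intro a b ha hb
    apply ContinuousOn.intervalIntegrable
    apply hco.mono
    intro u hu
    exact le_trans (le_min ha hb) hu.1
  have hHd : ∀ s > t₁, HasDerivAt H (h s) s := by
    intro s hs
    refine intervalIntegral.integral_hasDerivAt_right (hII _ _ le_rfl hs.le) ?_ (hc s hs.le)
    exact ContinuousOn.stronglyMeasurableAtFilter_nhdsWithin (s := Set.Ioi t₁)
      (hco.mono Set.Ioi_subset_Ici_self) measurableSet_Ioi s |>.filter_mono
        (by rw [IsOpen.nhdsWithin_eq isOpen_Ioi hs])
  have hlim := intervalIntegral_tendsto_integral_Ioi t₁ hi tendsto_id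
  set l := ∫ u in Set.Ioi t₁, h u with hl
  have hlim' : Tendsto H atTop (nhds l) := hlim
  have hmono : MonotoneOn H (Set.Ioi t₁) := by
    apply monotoneOn_of_deriv_nonneg (convex_Ioi t₁)
    · exact fun s hs => (hHd s hs).continuousAt.continuousWithinAt
    · rw [interior_Ioi]
      exact fun s hs => (hHd s hs).differentiableAt.differentiableWithinAt
    · rw [interior_Ioi]
      intro s hs
      rw [(hHd s hs).deriv]; exact hh s (le_of_lt hs)
  have hHl : ∀ s > t₁, H s ≤ l := by
    intro s hs
    apply ge_of_tendsto hlim'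
    filter_upwards [eventually_ge_atTop s] with u hu
    exact hmono hs (lt_of_lt_of_le hs hu) hu
  have key : ∀ T > t₁, ∀ t ≥ T, E t ≤ E T + C * t ^ 2 * (l - H T) := by
    intro T hT t ht
    have hd : ∀ s ≥ T, HasDerivAt (fun s => E s - C * t ^ 2 * H s) (E' s - C * t ^ 2 * h s) s := by
      intro s hs
      have hs1 : s > t₁ := lt_of_lt_of_le hT hs
      exact (hE s hs1.le).sub ((hHd s hs1).const_mul _)
    have : AntitoneOn (fun s => E s - C * t ^ 2 * H s) (Set.Icc T t) := by
      apply antitoneOn_of_deriv_nonpos (convex_Icc T t)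
      · exact fun s hs => (hd s hs.1).continuousAt.continuousWithinAt
      · rw [interior_Icc]
        exact fun s hs => (hd s hs.1.le).differentiableAt.differentiableWithinAt
      · rw [interior_Icc]
        intro s hs
        rw [(hd s hs.1.le).deriv]
        have hs1 : s ≥ t₁ := hT.le.trans hs.1.le
        have h1 := hE' s hs1
        have h2 : s ^ 2 ≤ t ^ 2 := pow_le_pow_left₀ (ht₁.le.trans hs1) hs.2.le 2
        have h3 := mul_le_mul_of_nonneg_left (mul_le_mul_of_nonneg_right h2 (hh s hs1)) hC
        linarith
    have h4 := this (Set.left_mem_Icc.2 ht) (Set.right_mem_Icc.2 ht) ht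
    simp only at h4
    have h5 : C * t ^ 2 * H t ≤ C * t ^ 2 * l :=
      mul_le_mul_of_nonneg_left (hHl t (lt_of_lt_of_le hT ht)) (by positivity)
    linarith
  rw [Metric.tendsto_atTop]
  intro δ hδ
  have h6 : Tendsto (fun T => C * (l - H T)) atTop (nhds (C * (l - l))) :=
    (tendsto_const_nhds.sub hlim').const_mul C
  rw [sub_self, mul_zero] at h6
  obtain ⟨T, hT1, hT2⟩ := ((h6.eventually (gt_mem_nhds (half_pos hδ))).and
    (eventually_gt_atTop t₁)).exists
  have h7 : Tendsto (fun t : ℝ => E T / t ^ 2) atTop (nhds 0) :=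
    tendsto_const_nhds.div_atTop (tendsto_pow_atTop two_ne_zero)
  obtain ⟨N, hN⟩ := eventually_atTop.1 (h7.eventually (gt_mem_nhds (half_pos hδ)))
  refine ⟨max N T, fun t ht => ?_⟩
  have htT : t ≥ T := (le_max_right _ _).trans ht
  have ht1 : t > t₁ := lt_of_lt_of_le hT2 htT
  have htp : 0 < t := ht₁.trans ht1
  have h8 := hN t ((le_max_left _ _).trans ht)
  have h9 := key T hT2 t htT
  have h10 : 0 ≤ E t / t ^ 2 := div_nonneg (hE0 t ht1.le) (by positivity)
  rw [Real.dist_eq, sub_zero, abs_of_nonneg h10]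
  have h11 : E t / t ^ 2 ≤ E T / t ^ 2 + C * (l - H T) := by
    rw [div_add' _ _ _ (by positivity)]
    apply div_le_div_of_nonneg_right _ (by positivity)
    linarith
  linarith

lemma convex_grad {F : Type*} [NormedAddCommGroup F] [InnerProductSpace ℝ F] [CompleteSpace F]
    (f : F → ℝ) (hf : Differentiable ℝ f) (hc : ConvexOn ℝ Set.univ f) (a b : F) :
    f a - f b ≤ ⟪gradient f a, a - b⟫ := by
  have hg : HasFDerivAt f (InnerProductSpace.toDual ℝ F (gradient f a)) a :=
    (hf a).hasGradientAt.hasFDerivAt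
  have hl : HasDerivAt (fun s : ℝ => a + s • (b - a)) (b - a) 0 := by
    simpa using ((hasDerivAt_id (0:ℝ)).smul_const (b - a)).const_add a
  have hd : HasDerivAt (fun s : ℝ => f (a + s • (b - a))) ⟪gradient f a, b - a⟫ 0 := by
    have hg' : HasFDerivAt f (InnerProductSpace.toDual ℝ F (gradient f a))
      (a + (0:ℝ) • (b - a)) := by simpa using hg
    exact hg'.comp_hasDerivAt (0:ℝ) hl
  have hcv : ConvexOn ℝ Set.univ (fun s : ℝ => f (a + s • (b - a))) := by
    refine ⟨convex_univ, fun p _ q _ c d hc' hd' hcd => ?_⟩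
    have := hc.2 (Set.mem_univ (a + p • (b - a))) (Set.mem_univ (a + q • (b - a))) hc' hd' hcd
    refine le_trans (le_of_eq ?_) this
    obtain rfl : d = 1 - c := by linarith
    have e : a + (c • p + (1 - c) • q) • (b - a)
        = c • (a + p • (b - a)) + (1 - c) • (a + q • (b - a)) := by
      simp only [smul_eq_mul]
      module
    exact congrArg f e
  have := hcv.le_slope_of_hasDerivAt (Set.mem_univ 0) (Set.mem_univ 1) one_pos hd
  simp only [slope_def_field, one_smul, zero_smul, add_zero, sub_zero, div_one, add_sub_cancel] at this
  have e : ⟪gradient f a, a - b⟫ = - ⟪gradient f a, b - a⟫ := by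
    rw [← inner_neg_right, neg_sub]
  rw [e]; linarith

lemma comp_grad {F : Type*} [NormedAddCommGroup F] [InnerProductSpace ℝ F] [CompleteSpace F]
    (f : F → ℝ) (hf : Differentiable ℝ f) (x : ℝ → F) (x' : F) (t : ℝ) (hx : HasDerivAt x x' t) :
    HasDerivAt (fun s => f (x s)) ⟪gradient f (x t), x'⟫ t := by
  have hg : HasFDerivAt f (InnerProductSpace.toDual ℝ F (gradient f (x t))) (x t) :=
    (hf _).hasGradientAt.hasFDerivAt
  exact hg.comp_hasDerivAt t hx

lemma hasDerivs {F : Type*} [NormedAddCommGroup F] [NormedSpace ℝ F] (t₀ : ℝ) (x : ℝ → F)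
    (hx : ContDiffOn ℝ 2 x (Set.Ici t₀)) (t : ℝ) (ht : t₀ < t) :
    HasDerivAt x (deriv x t) t ∧ HasDerivAt (deriv x) (deriv (deriv x) t) t := by
  have h1 : ContDiffOn ℝ (1 + 1) x (Set.Ioi t₀) := by
    have := hx.mono (Set.Ioi_subset_Ici_self)
    exact this.of_le (by norm_num)
  have h2 := (contDiffOn_succ_iff_deriv_of_isOpen isOpen_Ioi).1 h1
  refine ⟨?_, ?_⟩
  · exact (h2.1.differentiableAt (Ioi_mem_nhds ht)).hasDerivAt
  · exact ((h2.2.2.differentiableOn one_ne_zero).differentiableAt (Ioi_mem_nhds ht)).hasDerivAt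

lemma hasDeriv1 (t₀ : ℝ) (x : ℝ → ℝ)
    (hx : ContDiffOn ℝ 1 x (Set.Ici t₀)) (t : ℝ) (ht : t₀ < t) :
    HasDerivAt x (deriv x t) t :=
  ((hx.differentiableOn one_ne_zero).differentiableAt (Ici_mem_nhds ht)).hasDerivAt

lemma final_lim {F : Type*} [NormedAddCommGroup F] [NormedSpace ℝ F] (t₁ θ D : ℝ) (ht₁ : 0 < t₁)
    (hθ : 0 < θ) (hD : 0 < D) (E : ℝ → ℝ) (x x' : ℝ → F) (xs : F)
    (hE : Tendsto (fun t => E t / t ^ 2) atTop (nhds 0))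
    (h1 : ∀ t ≥ t₁, 1 / 2 * ‖x t - xs + (θ * t) • x' t‖ ^ 2 ≤ E t)
    (h2 : ∀ t ≥ t₁, D / 2 * ‖x t - xs‖ ^ 2 ≤ E t) :
    Tendsto (fun t => ‖x' t‖) atTop (nhds 0) := by
  have hsq : Tendsto (fun t => √(2 * (E t / t ^ 2))) atTop (nhds 0) := by
    have := (hE.const_mul 2).sqrt
    simpa using this
  have hsq2 : Tendsto (fun t => √(2 / D * (E t / t ^ 2))) atTop (nhds 0) := by
    have := (hE.const_mul (2 / D)).sqrt
    simpa using this
  have hs := (hsq.add hsq2).div_const θ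
  rw [add_zero, zero_div] at hs
  refine squeeze_zero' (Eventually.of_forall fun t => norm_nonneg _) ?_ hs
  filter_upwards [eventually_ge_atTop t₁] with t ht
  have htp : 0 < t := ht₁.trans_le ht
  have a1 : ‖x t - xs + (θ * t) • x' t‖ / t ≤ √(2 * (E t / t ^ 2)) := by
    apply Real.le_sqrt_of_sq_le
    rw [div_pow, ← mul_div_assoc]
    apply div_le_div_of_nonneg_right _ (by positivity)
    linarith [h1 t ht]
  have a2 : ‖x t - xs‖ / t ≤ √(2 / D * (E t / t ^ 2)) := by
    apply Real.le_sqrt_of_sq_le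
    rw [div_pow, ← mul_div_assoc]
    apply div_le_div_of_nonneg_right _ (by positivity)
    have := h2 t ht
    rw [div_mul_eq_mul_div, le_div_iff₀ hD]
    linarith
  rw [le_div_iff₀ hθ]
  have a3 : ‖(θ * t) • x' t‖ ≤ ‖x t - xs + (θ * t) • x' t‖ + ‖x t - xs‖ := by
    have := norm_sub_le (x t - xs + (θ * t) • x' t) (x t - xs)
    simpa using this
  rw [norm_smul, Real.norm_of_nonneg (by positivity)] at a3
  have a4 : ‖x' t‖ * θ ≤ ‖x t - xs + (θ * t) • x' t‖ / t + ‖x t - xs‖ / t := by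
    rw [← add_div, le_div_iff₀ htp]; linarith
  linarith

/-- Theorem 3.2(1): under the slow-decay condition
`∫ β(t)ε(t)/t dt < ∞` and `θtα(t) − θ − 1 ≥ D₂ > 0`, the velocities vanish:
`‖ẋ(t)‖ → 0` and `‖ẏ(t)‖ → 0`. -/
theorem stmt_15 {n m : ℕ} (t₀ θ : ℝ) (ht₀ : 0 < t₀) (hθ : 0 < θ)
    (f : EuclideanSpace ℝ (Fin n) → ℝ) (g : EuclideanSpace ℝ (Fin m) → ℝ)
    (hf : Differentiable ℝ f) (hg : Differentiable ℝ g)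
    (hfconv : ConvexOn ℝ Set.univ f) (hgconv : ConvexOn ℝ Set.univ g)
    (K : EuclideanSpace ℝ (Fin n) →L[ℝ] EuclideanSpace ℝ (Fin m))
    (α β ε : ℝ → ℝ)
    (hαC1 : ContDiffOn ℝ 1 α (Set.Ici t₀)) (hβC1 : ContDiffOn ℝ 1 β (Set.Ici t₀))
    (hεC1 : ContDiffOn ℝ 1 ε (Set.Ici t₀))
    (hαpos : ∀ t ≥ t₀, 0 < α t) (hβpos : ∀ t ≥ t₀, 0 < β t) (hεpos : ∀ t ≥ t₀, 0 < ε t)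
    (hα : ∀ t ≥ t₀, (1 + θ) / (θ * t) ≤ α t)
    (hβ' : ∀ t ≥ t₀, deriv β t / β t ≤ (1 - 2 * θ) / (θ * t))
    (hαε : ∀ t ≥ t₀, α t + t * deriv α t ≤ t * β t * ε t)
    (hεanti : AntitoneOn ε (Set.Ici t₀))
    (hεint : IntegrableOn (fun t => β t * ε t / t) (Set.Ioi t₀))
    (hD₂ : ∃ D₂ > 0, ∀ t ≥ t₀, D₂ ≤ θ * t * α t - θ - 1)
    (hΩ : ∃ p : EuclideanSpace ℝ (Fin n) × EuclideanSpace ℝ (Fin m),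
      IsSaddle f g K p.1 p.2)
    (x : ℝ → EuclideanSpace ℝ (Fin n)) (y : ℝ → EuclideanSpace ℝ (Fin m))
    (hsol : IsSol t₀ θ f g K α β ε x y) :
    Tendsto (fun t => ‖deriv x t‖) atTop (nhds 0) ∧
    Tendsto (fun t => ‖deriv y t‖) atTop (nhds 0) := by
  obtain ⟨D, hD, hDb⟩ := hD₂
  obtain ⟨⟨xs, ys⟩, hsad⟩ := hΩ
  simp only at hsad
  obtain ⟨hx2, hy2, hode⟩ := hsol
  set t₁ := t₀ + 1 with ht₁
  have h01 : t₀ < t₁ := by linarith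
  have ht₁p : 0 < t₁ := by linarith
  set G : ℝ → ℝ := fun s => f (x s) + ⟪K (x s), ys⟫ - ⟪K xs, y s⟫ + g (y s) - f xs - g ys with hG
  have hG0 : ∀ s, 0 ≤ G s := by
    intro s
    have h1 := hsad (x s) (y s)
    simp only [Lag] at h1
    simp only [hG]
    linarith [h1.1, h1.2]
  set E : ℝ → ℝ := fun s => θ ^ 2 * s ^ 2 * β s * (G s + ε s / 2 * (‖x s‖ ^ 2 + ‖y s‖ ^ 2))
    + 1 / 2 * ‖x s - xs + (θ * s) • deriv x s‖ ^ 2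
    + 1 / 2 * ‖y s - ys + (θ * s) • deriv y s‖ ^ 2
    + (θ * s * α s - θ - 1) / 2 * (‖x s - xs‖ ^ 2 + ‖y s - ys‖ ^ 2) with hE
  have hB0 : ∀ s ≥ t₁, 0 ≤ θ ^ 2 * s ^ 2 * β s * (G s + ε s / 2 * (‖x s‖ ^ 2 + ‖y s‖ ^ 2)) := by
    intro s hs
    have hs0 : s ≥ t₀ := h01.le.trans hs
    have := hβpos s hs0
    have := hεpos s hs0
    have := hG0 s
    positivity
  have hD0 : ∀ s ≥ t₁, D / 2 * (‖x s - xs‖ ^ 2 + ‖y s - ys‖ ^ 2) ≤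
      (θ * s * α s - θ - 1) / 2 * (‖x s - xs‖ ^ 2 + ‖y s - ys‖ ^ 2) := by
    intro s hs
    have := hDb s (h01.le.trans hs)
    apply mul_le_mul_of_nonneg_right _ (by positivity)
    linarith
  have hder : ∀ s > t₀, HasDerivAt E (
      (2 * θ ^ 2 * s * β s + θ ^ 2 * s ^ 2 * deriv β s) * (G s + ε s / 2 * (‖x s‖ ^ 2 + ‖y s‖ ^ 2))
      - θ * s * β s * ((⟪gradient f (x s), x s - xs⟫ + ⟪K (x s - xs), ys⟫ + ε s * ⟪x s, x s - xs⟫)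
        + (⟪gradient g (y s), y s - ys⟫ - ⟪K xs, y s - ys⟫ + ε s * ⟪y s, y s - ys⟫))
      + θ * s * (1 + θ - θ * s * α s) * (‖deriv x s‖ ^ 2 + ‖deriv y s‖ ^ 2)
      + θ / 2 * (α s + s * deriv α s) * (‖x s - xs‖ ^ 2 + ‖y s - ys‖ ^ 2)
      + θ ^ 2 * s ^ 2 * β s * (deriv ε s / 2) * (‖x s‖ ^ 2 + ‖y s‖ ^ 2)) s := by
    intro s hs
    obtain ⟨dx, ddx⟩ := hasDerivs t₀ x hx2 s hs
    obtain ⟨dy, ddy⟩ := hasDerivs t₀ y hy2 s hs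
    have dα := hasDeriv1 t₀ α hαC1 s hs
    have dβ := hasDeriv1 t₀ β hβC1 s hs
    have dε := hasDeriv1 t₀ ε hεC1 s hs
    have did := hasDerivAt_id' s
    have dG : HasDerivAt G (⟪gradient f (x s), deriv x s⟫ + ⟪K (deriv x s), ys⟫
        - ⟪K xs, deriv y s⟫ + ⟪gradient g (y s), deriv y s⟫) s := by
      have e1 : HasDerivAt (fun s => ⟪K (x s), ys⟫) ⟪K (deriv x s), ys⟫ s := by
        have := (K.hasFDerivAt.comp_hasDerivAt s dx).inner ℝ (hasDerivAt_const s ys)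
        simpa using this
      have e2 : HasDerivAt (fun s => ⟪K xs, y s⟫) ⟪K xs, deriv y s⟫ s := by
        have := (hasDerivAt_const s (K xs)).inner ℝ dy
        simpa using this
      exact (((((comp_grad f hf x _ s dx).add e1).sub e2).add
        (comp_grad g hg y _ s dy)).sub_const _).sub_const _
    have dvx : HasDerivAt (fun s => x s - xs + (θ * s) • deriv x s)
        (deriv x s + ((θ * s) • deriv (deriv x) s + θ • deriv x s)) s := by
      have := (dx.sub_const xs).add ((did.const_mul θ).smul ddx)
      rw [mul_one] at this
      exact this
    have dvy : HasDerivAt (fun s => y s - ys + (θ * s) • deriv y s)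
        (deriv y s + ((θ * s) • deriv (deriv y) s + θ • deriv y s)) s := by
      have := (dy.sub_const ys).add ((did.const_mul θ).smul ddy)
      rw [mul_one] at this
      exact this
    have dE := (((((did.pow 2).const_mul (θ ^ 2)).mul dβ).mul
      (dG.add ((dε.div_const 2).mul (dx.norm_sq.add dy.norm_sq)))).add
      (dvx.norm_sq.const_mul (1 / 2))).add (dvy.norm_sq.const_mul (1 / 2)) |>.add
      ((((((did.const_mul θ).mul dα).sub_const θ).sub_const 1).div_const 2).mul
        ((dx.sub_const xs).norm_sq.add (dy.sub_const ys).norm_sq))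
    refine dE.congr_deriv ?_
    obtain ⟨o1, o2⟩ := hode s hs.le
    have o1' : deriv (deriv x) s = -(α s • deriv x s) - β s • (gradient f (x s) + ε s • x s
        + (ContinuousLinearMap.adjoint K) (y s + (θ * s) • deriv y s)) := by
      rw [← sub_eq_zero, ← o1]; abel
    have o2' : deriv (deriv y) s = -(α s • deriv y s) + β s • (K (x s + (θ * s) • deriv x s)
        - gradient g (y s) - ε s • y s) := by
      rw [← sub_eq_zero, ← o2]; abel
    rw [o1', o2']
    simp only [Pi.add_apply, Pi.mul_apply, Pi.pow_apply]
    generalize gradient f (x s) = p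
    generalize gradient g (y s) = q
    generalize deriv x s = u
    generalize deriv y s = v
    generalize x s = a
    generalize y s = b
    simp only [inner_add_left, inner_add_right, inner_sub_left, inner_sub_right, inner_neg_right,
      real_inner_smul_left, real_inner_smul_right, map_add, map_sub, map_smul,
      ContinuousLinearMap.adjoint_inner_right, ← real_inner_self_eq_norm_sq]
    rw [real_inner_comm p u, real_inner_comm q v, real_inner_comm a xs, real_inner_comm b ys,
      real_inner_comm a u, real_inner_comm b v, real_inner_comm p a, real_inner_comm p xs,
      real_inner_comm q b, real_inner_comm q ys, real_inner_comm (K a) b, real_inner_comm (K a) ys,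
      real_inner_comm (K a) v, real_inner_comm (K u) b, real_inner_comm (K u) ys,
      real_inner_comm (K u) v]
    push_cast
    ring
  have hbound : ∀ s ≥ t₁, deriv E s ≤ (θ / 2 * (‖xs‖ ^ 2 + ‖ys‖ ^ 2)) * (s ^ 2 * (β s * ε s / s)) := by
    intro s hs
    have hs' : t₀ < s := h01.trans_le hs
    have hs0 : s ≥ t₀ := hs'.le
    have hsp : 0 < s := ht₀.trans hs'
    rw [(hder s hs').deriv]
    have b1 := hβpos s hs0
    have b2 := hεpos s hs0
    have b3 : deriv ε s ≤ 0 := by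
      have := hεanti.derivWithin_nonpos (x := s)
      rwa [derivWithin_of_mem_nhds (Ici_mem_nhds hs')] at this
    have b4 : 2 * θ ^ 2 * s * β s + θ ^ 2 * s ^ 2 * deriv β s ≤ θ * s * β s := by
      have := hβ' s hs0
      rw [div_le_div_iff₀ b1 (by positivity)] at this
      have := mul_le_mul_of_nonneg_left this (by positivity : 0 ≤ θ * s)
      linarith
    have b5 := hαε s hs0
    have b6 := hDb s hs0
    have c1 := convex_grad f hf hfconv (x s) xs
    have c2 := convex_grad g hg hgconv (y s) ys
    have cx : ⟪x s, x s - xs⟫ = (‖x s‖ ^ 2 + ‖x s - xs‖ ^ 2 - ‖xs‖ ^ 2) / 2 := by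
      rw [norm_sub_sq_real, inner_sub_right, real_inner_self_eq_norm_sq]; ring
    have cy : ⟪y s, y s - ys⟫ = (‖y s‖ ^ 2 + ‖y s - ys‖ ^ 2 - ‖ys‖ ^ 2) / 2 := by
      rw [norm_sub_sq_real, inner_sub_right, real_inner_self_eq_norm_sq]; ring
    have cG : G s ≤ ⟪gradient f (x s), x s - xs⟫ + ⟪K (x s - xs), ys⟫ +
        (⟪gradient g (y s), y s - ys⟫ - ⟪K xs, y s - ys⟫) := by
      simp only [hG, map_sub, inner_sub_left, inner_sub_right] at c1 c2 ⊢
      linarith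
    have e1 := mul_le_mul_of_nonneg_right b4
      (by have := hG0 s; positivity : 0 ≤ G s + ε s / 2 * (‖x s‖ ^ 2 + ‖y s‖ ^ 2))
    have e2 := mul_le_mul_of_nonneg_left cG (by positivity : 0 ≤ θ * s * β s)
    have e3 : θ * s * (1 + θ - θ * s * α s) * (‖deriv x s‖ ^ 2 + ‖deriv y s‖ ^ 2) ≤ 0 := by
      apply mul_nonpos_of_nonpos_of_nonneg _ (by positivity)
      apply mul_nonpos_of_nonneg_of_nonpos (by positivity)
      linarith
    have e4 := mul_le_mul_of_nonneg_right (mul_le_mul_of_nonneg_left b5 (by positivity : 0 ≤ θ / 2))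
      (by positivity : 0 ≤ ‖x s - xs‖ ^ 2 + ‖y s - ys‖ ^ 2)
    have e5 : θ ^ 2 * s ^ 2 * β s * (deriv ε s / 2) * (‖x s‖ ^ 2 + ‖y s‖ ^ 2) ≤ 0 := by
      apply mul_nonpos_of_nonpos_of_nonneg _ (by positivity)
      apply mul_nonpos_of_nonneg_of_nonpos (by positivity)
      linarith
    have e6 : s ^ 2 * (β s * ε s / s) = s * (β s * ε s) := by field_simp
    rw [e6, cx, cy]
    linarith
  have hlim : Tendsto (fun t => E t / t ^ 2) atTop (nhds 0) := by
    refine energy_decay t₁ (θ / 2 * (‖xs‖ ^ 2 + ‖ys‖ ^ 2)) E (deriv E) (fun s => β s * ε s / s)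
      ht₁p (by positivity) ?_ hbound ?_ ?_ ?_ ?_
    · intro s hs
      exact (hder s (h01.trans_le hs)).differentiableAt.hasDerivAt
    · intro s hs
      have h1 := hB0 s hs
      have h2 := hD0 s hs
      have h3 : 0 ≤ D / 2 * (‖x s - xs‖ ^ 2 + ‖y s - ys‖ ^ 2) := by positivity
      have h4 : 0 ≤ 1 / 2 * ‖x s - xs + (θ * s) • deriv x s‖ ^ 2 := by positivity
      have h5 : 0 ≤ 1 / 2 * ‖y s - ys + (θ * s) • deriv y s‖ ^ 2 := by positivity
      simp only [hE]
      linarith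
    · intro s hs
      have hs0 : s ≥ t₀ := h01.le.trans hs
      have h1 := hβpos s hs0
      have h2 := hεpos s hs0
      have h3 : 0 < s := ht₁p.trans_le hs
      positivity
    · intro s hs
      have hs0 : s > t₀ := h01.trans_le hs
      have h3 : s ≠ 0 := (ht₁p.trans_le hs).ne'
      exact ((hasDeriv1 t₀ β hβC1 s hs0).continuousAt.mul
        (hasDeriv1 t₀ ε hεC1 s hs0).continuousAt).div continuousAt_id h3
    · exact hεint.mono_set (Set.Ioi_subset_Ioi h01.le)
  constructor
  · apply final_lim t₁ θ D ht₁p hθ hD E x (deriv x) xs hlim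
    all_goals
      intro s hs
      have h1 := hB0 s hs
      have h2 := hD0 s hs
      have h3 : 0 ≤ D / 2 * ‖y s - ys‖ ^ 2 := by positivity
      have h3' : 0 ≤ D / 2 * ‖x s - xs‖ ^ 2 := by positivity
      have h4 : 0 ≤ 1 / 2 * ‖x s - xs + (θ * s) • deriv x s‖ ^ 2 := by positivity
      have h5 : 0 ≤ 1 / 2 * ‖y s - ys + (θ * s) • deriv y s‖ ^ 2 := by positivity
      simp only [hE]
      linarith
  · apply final_lim t₁ θ D ht₁p hθ hD E y (deriv y) ys hlim
    all_goals
      intro s hs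
      have h1 := hB0 s hs
      have h2 := hD0 s hs
      have h3 : 0 ≤ D / 2 * ‖y s - ys‖ ^ 2 := by positivity
      have h3' : 0 ≤ D / 2 * ‖x s - xs‖ ^ 2 := by positivity
      have h4 : 0 ≤ 1 / 2 * ‖x s - xs + (θ * s) • deriv x s‖ ^ 2 := by positivity
      have h5 : 0 ≤ 1 / 2 * ‖y s - ys + (θ * s) • deriv y s‖ ^ 2 := by positivity
      simp only [hE]
      linarith
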